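/- Let ℓ ∈ 𝓛(T). For ε > 0 let (p̂(ε), ẑ(ε)) be the unique solution of the Euler–Lagrange system (F'z)' = −C'z + H'û + p, (Fp)' = Cp + εQ⁻¹z, û = (1/ε)RHp, Fp(t0) = 0, F'z(T) + F⁺Fp(T) = F'ℓ, and set û(ε) := (1/ε)RHp̂(ε). Let (û, ẑ) be the unique pair minimizing ∫_{t0}^T ⟨Q(t)⁻¹z(t), z(t)⟩ dt + ∫_{t0}^T ⟨R(t)⁻¹u(t), u(t)⟩ dt over all pairs (u,z) such that z solves the adjoint DAE with data (u,ℓ). Then û(ε) → û in L²(t0,T;ℝᵖ) and ẑ(ε) → ẑ in L²(t0,T;ℝᵐ) as ε → 0. (Proposition 1 (Tikhonov regularization), convergence part.) -/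

import Mathlib

open Matrix Set
open scoped ENNReal

noncomputable section

/-- `x : ℝ → E` is (a representative of an element of) `L²(t0,T;E)`. -/
def L2On {E : Type*} [NormedAddCommGroup E] (t0 T : ℝ) (x : ℝ → E) : Prop :=
  MeasureTheory.AEStronglyMeasurable x (MeasureTheory.volume.restrict (Icc t0 T)) ∧
    MeasureTheory.IntegrableOn (fun t => ‖x t‖ ^ 2) (Icc t0 T) MeasureTheory.volume

/-- An admissible noise: a jointly measurable stochastic process `η` on some probability
space, with values in `ℝᵖ`, zero mean for a.e. `t ∈ [t0,T]`, and
`∫_{t0}^T ⟨R(t)η(t,ω), η(t,ω)⟩ dt ≤ 1` for almost every `ω`. -/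
structure Noise (t0 T : ℝ) (p : ℕ) (R : ℝ → Matrix (Fin p) (Fin p) ℝ) where
  Omega : Type
  [instMeas : MeasurableSpace Omega]
  P : MeasureTheory.Measure Omega
  [isProb : MeasureTheory.IsProbabilityMeasure P]
  η : ℝ → Omega → (Fin p → ℝ)
  jointMeas : Measurable (Function.uncurry η)
  zeroMean : ∀ᵐ t ∂(MeasureTheory.volume.restrict (Icc t0 T)), (∫ ω, η t ω ∂P) = 0
  bound : ∀ᵐ ω ∂P, (∫ t in t0..T, ((R t) *ᵥ (η t ω)) ⬝ᵥ (η t ω)) ≤ 1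

attribute [instance] Noise.instMeas Noise.isProb

open MeasureTheory

/-- `x` solves the DAE `(Fx)' = C(t)x + f`, `Fx(t0) = 0`, in the integral sense:
`Fx(t) = ∫_{t0}^t (C(s)x(s) + f(s)) ds` for all `t ∈ [t0,T]`, with `x ∈ L²`. -/
def SolvesDAE {m n : ℕ} (t0 T : ℝ) (F : Matrix (Fin m) (Fin n) ℝ)
    (C : ℝ → Matrix (Fin m) (Fin n) ℝ) (f : ℝ → (Fin m → ℝ)) (x : ℝ → (Fin n → ℝ)) : Prop :=
  L2On t0 T x ∧ ∀ t ∈ Icc t0 T, F *ᵥ x t = ∫ s in t0..t, ((C s) *ᵥ x s + f s)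

/-- The ellipsoid `G` of admissible inputs: `f ∈ L²` with `∫_{t0}^T ⟨Q(t)f(t), f(t)⟩ dt ≤ 1`. -/
def MemG {m : ℕ} (t0 T : ℝ) (Q : ℝ → Matrix (Fin m) (Fin m) ℝ) (f : ℝ → (Fin m → ℝ)) : Prop :=
  L2On t0 T f ∧ (∫ t in t0..T, ((Q t) *ᵥ f t) ⬝ᵥ f t) ≤ 1

/-- `z` solves the adjoint DAE with data `(u,ℓ)`:  `F'z` is absolutely continuous,
`(F'z)' = −C'(t)z + H'(t)u` a.e., `F'z(T) = F'ℓ`; in the equivalent integral form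
`F'z(t) = F'ℓ − ∫_t^T (−C'(s)z(s) + H'(s)u(s)) ds` for all `t ∈ [t0,T]`, with `z ∈ L²`. -/
def SolvesAdjoint {m n p : ℕ} (t0 T : ℝ) (F : Matrix (Fin m) (Fin n) ℝ)
    (C : ℝ → Matrix (Fin m) (Fin n) ℝ) (H : ℝ → Matrix (Fin p) (Fin n) ℝ)
    (u : ℝ → (Fin p → ℝ)) (ℓ : Fin m → ℝ) (z : ℝ → (Fin m → ℝ)) : Prop :=
  L2On t0 T z ∧ ∀ t ∈ Icc t0 T,
    Fᵀ *ᵥ z t = Fᵀ *ᵥ ℓ - ∫ s in t..T, (-((C s)ᵀ *ᵥ z s) + (H s)ᵀ *ᵥ u s)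

/-- The mean-squared estimation error of the estimation `u` in the direction `ℓ`,
for a given input `f`, solution `x` and noise `η`:
`E[⟨ℓ, Fx(T)⟩ − ∫_{t0}^T ⟨u(t), H(t)x(t) + η(t)⟩ dt]²`. -/
def errSq {m n p : ℕ} (t0 T : ℝ) (F : Matrix (Fin m) (Fin n) ℝ)
    (H : ℝ → Matrix (Fin p) (Fin n) ℝ) {R : ℝ → Matrix (Fin p) (Fin p) ℝ}
    (ℓ : Fin m → ℝ) (u : ℝ → (Fin p → ℝ)) (x : ℝ → (Fin n → ℝ))
    (N : Noise t0 T p R) : ℝ :=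
  ∫ ω, (ℓ ⬝ᵥ (F *ᵥ x T) - ∫ t in t0..T, (u t) ⬝ᵥ ((H t) *ᵥ x t + N.η t ω)) ^ 2 ∂N.P

/-- The worst-case mean-squared estimation error `σ(T,u,ℓ)` (valued in `ℝ≥0∞`,
so that finiteness can be expressed): the supremum of the mean-squared error over all
`f ∈ G`, all solutions `x` of the DAE with input `f`, and all admissible noises. -/
def sigmaErr {m n p : ℕ} (t0 T : ℝ) (F : Matrix (Fin m) (Fin n) ℝ)
    (C : ℝ → Matrix (Fin m) (Fin n) ℝ) (H : ℝ → Matrix (Fin p) (Fin n) ℝ)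
    (Q : ℝ → Matrix (Fin m) (Fin m) ℝ) (R : ℝ → Matrix (Fin p) (Fin p) ℝ)
    (u : ℝ → (Fin p → ℝ)) (ℓ : Fin m → ℝ) : ℝ≥0∞ :=
  ⨆ (f : ℝ → (Fin m → ℝ)) (x : ℝ → (Fin n → ℝ)) (N : Noise t0 T p R)
    (_ : MemG t0 T Q f) (_ : SolvesDAE t0 T F C f x),
      ENNReal.ofReal (errSq t0 T F H ℓ u x N)

/-- The minimax error `σ̂(T,ℓ) = inf_{u ∈ L²} σ(T,u,ℓ)`. -/
def sigmaHat {m n p : ℕ} (t0 T : ℝ) (F : Matrix (Fin m) (Fin n) ℝ)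
    (C : ℝ → Matrix (Fin m) (Fin n) ℝ) (H : ℝ → Matrix (Fin p) (Fin n) ℝ)
    (Q : ℝ → Matrix (Fin m) (Fin m) ℝ) (R : ℝ → Matrix (Fin p) (Fin p) ℝ)
    (ℓ : Fin m → ℝ) : ℝ≥0∞ :=
  ⨅ (u : ℝ → (Fin p → ℝ)) (_ : L2On t0 T u), sigmaErr t0 T F C H Q R u ℓ

open Topology Filter

/-- The four Penrose equations: `Fp` is the Moore–Penrose pseudoinverse of `F`. -/
def IsMoorePenrose {m n : ℕ} (F : Matrix (Fin m) (Fin n) ℝ)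
    (Fp : Matrix (Fin n) (Fin m) ℝ) : Prop :=
  F * Fp * F = F ∧ Fp * F * Fp = Fp ∧ (F * Fp)ᵀ = F * Fp ∧ (Fp * F)ᵀ = Fp * F

/-- `(p, z)` solves the Euler–Lagrange system
`(F'z)' = −C'z + H'û + p`, `(Fp)' = Cp + εQ⁻¹z`, `û = (1/ε)RHp`,
`Fp(t0) = 0`, `F'z(T) + F⁺Fp(T) = F'ℓ` (in the equivalent integral form, with
`p, z ∈ L²`, `Fp` and `F'z` absolutely continuous). -/
def SolvesEL {m n p : ℕ} (t0 T : ℝ) (F : Matrix (Fin m) (Fin n) ℝ)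
    (Fplus : Matrix (Fin n) (Fin m) ℝ)
    (C : ℝ → Matrix (Fin m) (Fin n) ℝ) (H : ℝ → Matrix (Fin p) (Fin n) ℝ)
    (Q : ℝ → Matrix (Fin m) (Fin m) ℝ) (R : ℝ → Matrix (Fin p) (Fin p) ℝ)
    (ε : ℝ) (ℓ : Fin m → ℝ) (pe : ℝ → (Fin n → ℝ)) (z : ℝ → (Fin m → ℝ)) : Prop :=
  L2On t0 T pe ∧ L2On t0 T z ∧
  (∀ t ∈ Icc t0 T,
    F *ᵥ pe t = ∫ s in t0..t, ((C s) *ᵥ pe s + ε • ((Q s)⁻¹ *ᵥ z s))) ∧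
  (∀ t ∈ Icc t0 T,
    Fᵀ *ᵥ z t = (Fᵀ *ᵥ ℓ - Fplus *ᵥ (F *ᵥ pe T)) -
      ∫ s in t..T,
        (-((C s)ᵀ *ᵥ z s) + (H s)ᵀ *ᵥ ((1 / ε) • ((R s) *ᵥ ((H s) *ᵥ pe s))) + pe s))

/-- In a Hilbert space, weak convergence to `0` of a bounded family against `S` extends to every
vector orthogonal to the orthogonal complement of `S`. -/
lemma tendsto_inner_zero_of_mem_biorthogonal {X α : Type*} [NormedAddCommGroup X]
    [InnerProductSpace ℝ X] [CompleteSpace X] (S : Set X) (g : X)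
    (hg : ∀ w, (∀ h ∈ S, inner ℝ h w = 0) → inner ℝ g w = 0)
    (l : Filter α) (w : α → X) (K : ℝ) (hK : ∀ᶠ a in l, ‖w a‖ ≤ K)
    (hS : ∀ h ∈ S, Tendsto (fun a => inner ℝ h (w a)) l (𝓝 0)) :
    Tendsto (fun a => inner ℝ g (w a)) l (𝓝 0) := by
  have hspan : ∀ h ∈ Submodule.span ℝ S, Tendsto (fun a => inner ℝ h (w a)) l (𝓝 0) := by
    intro h hh
    induction hh using Submodule.span_induction with
    | mem x hx => exact hS x hx
    | zero => simpa using tendsto_const_nhds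
    | add x y _ _ hx hy => simpa [inner_add_left] using hx.add hy
    | smul r x _ hx => simpa [inner_smul_left] using hx.const_mul r
  have hcl : g ∈ (Submodule.span ℝ S).topologicalClosure := by
    rw [← Submodule.orthogonal_orthogonal_eq_closure, Submodule.mem_orthogonal']
    intro w hw
    exact hg w fun h hh =>
      (Submodule.mem_orthogonal _ _).1 hw h (Submodule.subset_span hh)
  rw [Metric.tendsto_nhds]
  intro δ hδ
  have hK1 : 0 < |K| + 1 := by positivity
  obtain ⟨h, hh, hd⟩ := Metric.mem_closure_iff.1 hcl (δ / 2 / (|K| + 1)) (by positivity)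
  filter_upwards [hK, (Metric.tendsto_nhds.1 (hspan h hh)) (δ / 2) (by positivity)] with a ha hb
  rw [Real.dist_eq, sub_zero] at hb ⊢
  have hsplit : inner ℝ g (w a) = inner ℝ (g - h) (w a) + inner ℝ h (w a) := by
    rw [inner_sub_left]; ring
  have h1 : |inner ℝ (g - h) (w a)| ≤ δ / 2 := by
    calc |inner ℝ (g - h) (w a)| ≤ ‖g - h‖ * ‖w a‖ := abs_real_inner_le_norm _ _
      _ ≤ (δ / 2 / (|K| + 1)) * (|K| + 1) := by
          rw [dist_eq_norm] at hd
          gcongr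
          linarith [le_abs_self K]
      _ = δ / 2 := by field_simp
  rw [hsplit]
  linarith [abs_add_le (inner ℝ (g - h) (w a)) (inner ℝ h (w a))]

/-- The class in `L²` of a square integrable function with values in `ι → ℝ`. -/
def toL2 {ι : Type*} [Fintype ι] {μ : Measure ℝ} (f : ℝ → ι → ℝ) (hf : MemLp f 2 μ) :
    Lp (EuclideanSpace ℝ ι) 2 μ :=
  MemLp.toLp (fun t => WithLp.toLp 2 (f t)) (MemLp.of_eval_piLp fun i => hf.eval i)

lemma inner_toL2 {ι : Type*} [Fintype ι] {μ : Measure ℝ} {f g : ℝ → ι → ℝ}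
    (hf : MemLp f 2 μ) (hg : MemLp g 2 μ) :
    inner ℝ (toL2 f hf) (toL2 g hg) = ∫ t, f t ⬝ᵥ g t ∂μ := by
  rw [L2.inner_def]
  refine integral_congr_ae ?_
  filter_upwards [MemLp.coeFn_toLp (MemLp.of_eval_piLp (f := fun t => WithLp.toLp 2 (f t))
      fun i => hf.eval i),
    MemLp.coeFn_toLp (MemLp.of_eval_piLp (f := fun t => WithLp.toLp 2 (g t))
      fun i => hg.eval i)] with t h1 h2
  simp only [toL2, h1, h2, EuclideanSpace.inner_toLp_toLp, star_trivial]
  exact dotProduct_comm _ _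

lemma exists_eq_toL2 {ι : Type*} [Fintype ι] {μ : Measure ℝ} (w : Lp (EuclideanSpace ℝ ι) 2 μ) :
    ∃ (f : ℝ → ι → ℝ) (hf : MemLp f 2 μ), w = toL2 f hf := by
  refine ⟨fun t => WithLp.ofLp (w t), MemLp.of_eval fun i => (Lp.memLp w).eval_piLp i, ?_⟩
  exact (Lp.toLp_coeFn w (Lp.memLp w)).symm

/-- Function-level form of `tendsto_inner_zero_of_mem_biorthogonal` in `L²`. -/
lemma tendsto_integral_dotProduct_zero {ι α : Type*} [Fintype ι] {μ : Measure ℝ}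
    (S : Set (ℝ → ι → ℝ)) (hSL : ∀ h ∈ S, MemLp h 2 μ) (g : ℝ → ι → ℝ) (hgL : MemLp g 2 μ)
    (hg : ∀ w : ℝ → ι → ℝ, MemLp w 2 μ → (∀ h ∈ S, ∫ t, h t ⬝ᵥ w t ∂μ = 0) →
      ∫ t, g t ⬝ᵥ w t ∂μ = 0)
    (l : Filter α) (w : α → ℝ → ι → ℝ) (hw : ∀ᶠ a in l, MemLp (w a) 2 μ) (K : ℝ)
    (hK : ∀ᶠ a in l, ∫ t, w a t ⬝ᵥ w a t ∂μ ≤ K)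
    (hS : ∀ h ∈ S, Tendsto (fun a => ∫ t, h t ⬝ᵥ w a t ∂μ) l (𝓝 0)) :
    Tendsto (fun a => ∫ t, g t ⬝ᵥ w a t ∂μ) l (𝓝 0) := by
  classical
  let W : α → Lp (EuclideanSpace ℝ ι) 2 μ := fun a =>
    if ha : MemLp (w a) 2 μ then toL2 (w a) ha else 0
  have hW : ∀ᶠ a in l, ∃ ha : MemLp (w a) 2 μ, W a = toL2 (w a) ha :=
    hw.mono fun a ha => ⟨ha, by simp [W, ha]⟩
  have hinner : ∀ (h : ℝ → ι → ℝ) (hh : MemLp h 2 μ),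
      (fun a => inner ℝ (toL2 h hh) (W a)) =ᶠ[l] fun a => ∫ t, h t ⬝ᵥ w a t ∂μ := by
    intro h hh
    filter_upwards [hW] with a ⟨ha, hWa⟩
    rw [hWa, inner_toL2]
  refine (tendsto_inner_zero_of_mem_biorthogonal
    {x | ∃ (h : ℝ → ι → ℝ) (_ : h ∈ S) (hh : MemLp h 2 μ), x = toL2 h hh}
    (toL2 g hgL) ?_ l W (Real.sqrt K) ?_ ?_).congr' (hinner g hgL)
  · intro x hx
    obtain ⟨f, hf, rfl⟩ := exists_eq_toL2 x
    rw [inner_toL2]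
    refine hg f hf fun h hh => ?_
    rw [← inner_toL2 (hSL h hh) hf]
    exact hx _ ⟨h, hh, hSL h hh, rfl⟩
  · filter_upwards [hW, hK] with a ⟨ha, hWa⟩ hKa
    apply Real.le_sqrt_of_sq_le
    rw [← real_inner_self_eq_norm_sq, hWa, inner_toL2]
    exact hKa
  · rintro _ ⟨h, hhS, hh, rfl⟩
    exact (hS h hhS).congr' (hinner h hh).symm

lemma intervalIntegral_eq_integral_restrict_Icc {E : Type*} [NormedAddCommGroup E]
    [NormedSpace ℝ E] {a b : ℝ} (hab : a ≤ b) (f : ℝ → E) :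
    ∫ t in a..b, f t = ∫ t, f t ∂(volume.restrict (Icc a b)) := by
  rw [intervalIntegral.integral_of_le hab, integral_Icc_eq_integral_Ioc]

lemma l2On_iff_memLp {E : Type*} [NormedAddCommGroup E] {a b : ℝ} {x : ℝ → E} :
    L2On a b x ↔ MemLp x 2 (volume.restrict (Icc a b)) :=
  ⟨fun h => (memLp_two_iff_integrable_sq_norm h.1).2 h.2,
    fun h => ⟨h.1, (memLp_two_iff_integrable_sq_norm h.1).1 h⟩⟩

lemma memLp_of_continuousOn_Icc {E : Type*} [NormedAddCommGroup E] [SecondCountableTopology E]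
    {a b : ℝ} {f : ℝ → E} (hf : ContinuousOn f (Icc a b)) (q : ℝ≥0∞) :
    MemLp f q (volume.restrict (Icc a b)) := by
  obtain ⟨K, hK⟩ := isCompact_Icc.exists_bound_of_continuousOn hf
  exact MemLp.of_bound (hf.aestronglyMeasurable measurableSet_Icc) K
    ((ae_restrict_mem measurableSet_Icc).mono hK)

lemma memLp_mulVec {k l : ℕ} {a b : ℝ} {A : ℝ → Matrix (Fin k) (Fin l) ℝ}
    (hA : ContinuousOn A (Icc a b)) {x : ℝ → Fin l → ℝ}
    (hx : MemLp x 2 (volume.restrict (Icc a b))) :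
    MemLp (fun t => A t *ᵥ x t) 2 (volume.restrict (Icc a b)) := by
  refine MemLp.of_eval fun i => ?_
  simp only [mulVec, dotProduct]
  refine memLp_finsetSum _ fun j _ => ?_
  have hAij : ContinuousOn (fun t => A t i j) (Icc a b) :=
    (continuous_apply_apply i j).comp_continuousOn hA
  exact (hx.eval j).mul' (memLp_of_continuousOn_Icc hAij ⊤)

lemma integrable_dotProduct {ι : Type*} [Fintype ι] {μ : Measure ℝ} {f g : ℝ → ι → ℝ}
    (hf : MemLp f 2 μ) (hg : MemLp g 2 μ) : Integrable (fun t => f t ⬝ᵥ g t) μ := by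
  simp only [dotProduct]
  exact integrable_finsetSum _ fun i _ => (hf.eval i).integrable_mul (hg.eval i)

/-- Young's inequality for the dot product. -/
lemma abs_dotProduct_le {ι : Type*} [Fintype ι] (f g : ι → ℝ) {δ : ℝ} (hδ : 0 < δ) :
    |f ⬝ᵥ g| ≤ δ / 2 * (f ⬝ᵥ f) + 1 / (2 * δ) * (g ⬝ᵥ g) := by
  simp only [dotProduct, Finset.mul_sum]
  rw [← Finset.sum_add_distrib]
  refine (Finset.abs_sum_le_sum_abs _ _).trans (Finset.sum_le_sum fun i _ => ?_)
  have hsq : δ / 2 * (f i * f i) + 1 / (2 * δ) * (g i * g i)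
      = (1 / (2 * δ)) * ((δ * |f i|) ^ 2 + |g i| ^ 2) := by
    rw [mul_pow, sq_abs, sq_abs]; field_simp
  have hab : |f i * g i| = (1 / (2 * δ)) * (2 * (δ * |f i|) * |g i|) := by
    rw [abs_mul]; field_simp
  rw [hsq, hab]
  gcongr
  exact two_mul_le_add_sq _ _

/-- Young's inequality for the `L²` pairing. -/
lemma abs_integral_dotProduct_le {ι : Type*} [Fintype ι] {μ : Measure ℝ} {f g : ℝ → ι → ℝ}
    (hf : MemLp f 2 μ) (hg : MemLp g 2 μ) {δ : ℝ} (hδ : 0 < δ) :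
    |∫ t, f t ⬝ᵥ g t ∂μ| ≤ δ / 2 * ∫ t, f t ⬝ᵥ f t ∂μ + 1 / (2 * δ) * ∫ t, g t ⬝ᵥ g t ∂μ := by
  have hff := integrable_dotProduct hf hf
  have hgg := integrable_dotProduct hg hg
  rw [← integral_const_mul, ← integral_const_mul,
    ← integral_add (hff.const_mul _) (hgg.const_mul _)]
  exact abs_integral_le_integral_abs.trans
    (integral_mono (integrable_dotProduct hf hg).abs ((hff.const_mul _).add (hgg.const_mul _))
      fun t => abs_dotProduct_le (f t) (g t) hδ)

lemma continuousOn_matrix_inv {k : ℕ} {s : Set ℝ} {A : ℝ → Matrix (Fin k) (Fin k) ℝ}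
    (hA : ContinuousOn A s) (hpd : ∀ t ∈ s, (A t).PosDef) :
    ContinuousOn (fun t => (A t)⁻¹) s := by
  simp only [Matrix.inv_def, Ring.inverse_eq_inv']
  refine ContinuousOn.smul (ContinuousOn.inv₀ ?_ fun t ht => (hpd t ht).det_pos.ne') ?_
  · exact (continuous_id.matrix_det).comp_continuousOn hA
  · exact (continuous_id.matrix_adjugate).comp_continuousOn hA

lemma exists_coercive {k : ℕ} {a b : ℝ} {A : ℝ → Matrix (Fin k) (Fin k) ℝ}
    (hA : ContinuousOn A (Icc a b)) (hpd : ∀ t ∈ Icc a b, (A t).PosDef) :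
    ∃ c > 0, ∀ t ∈ Icc a b, ∀ v : Fin k → ℝ, c * (v ⬝ᵥ v) ≤ (A t *ᵥ v) ⬝ᵥ v := by
  have hcpt : IsCompact (Icc a b ×ˢ {v : Fin k → ℝ | v ⬝ᵥ v = 1}) := by
    refine isCompact_Icc.prod ?_
    refine Metric.isCompact_of_isClosed_isBounded ?_ ?_
    · exact isClosed_eq (by fun_prop) continuous_const
    · refine (Metric.isBounded_closedBall (x := (0 : Fin k → ℝ)) (r := 1)).subset fun v hv => ?_
      rw [mem_closedBall_zero_iff, pi_norm_le_iff_of_nonneg zero_le_one]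
      intro i
      rw [Real.norm_eq_abs, ← sq_le_one_iff_abs_le_one, ← (hv : v ⬝ᵥ v = 1), sq]
      exact Finset.single_le_sum (f := fun i => v i * v i) (fun j _ => mul_self_nonneg (v j))
        (Finset.mem_univ i)
  have hcont : ContinuousOn (fun x : ℝ × (Fin k → ℝ) => (A x.1 *ᵥ x.2) ⬝ᵥ x.2)
      (Icc a b ×ˢ {v : Fin k → ℝ | v ⬝ᵥ v = 1}) := by
    have hAij : ∀ i j, ContinuousOn (fun x : ℝ × (Fin k → ℝ) => A x.1 i j)
        (Icc a b ×ˢ {v : Fin k → ℝ | v ⬝ᵥ v = 1}) := fun i j =>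
      ContinuousOn.comp (t := Icc a b) (g := fun t => A t i j)
        ((continuous_apply_apply i j).comp_continuousOn hA) continuousOn_fst fun x hx => hx.1
    simp only [mulVec, dotProduct]
    refine continuousOn_finsetSum _ fun i _ => ContinuousOn.mul
      (continuousOn_finsetSum _ fun j _ => (hAij i j).mul ?_) ?_ <;> fun_prop
  have hposv : ∀ t ∈ Icc a b, ∀ v : Fin k → ℝ, v ≠ 0 → 0 < (A t *ᵥ v) ⬝ᵥ v := by
    intro t ht v hv
    have := (hpd t ht).dotProduct_mulVec_pos hv
    rwa [star_trivial, dotProduct_comm] at this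
  obtain ⟨c, hc, hle⟩ : ∃ c > 0, ∀ x ∈ Icc a b ×ˢ {v : Fin k → ℝ | v ⬝ᵥ v = 1},
      c ≤ (A x.1 *ᵥ x.2) ⬝ᵥ x.2 := by
    rcases (Icc a b ×ˢ {v : Fin k → ℝ | v ⬝ᵥ v = 1}).eq_empty_or_nonempty with he | hne
    · exact ⟨1, one_pos, by simp [he]⟩
    · obtain ⟨x, hx, hmin⟩ := hcpt.exists_isMinOn hne hcont
      refine ⟨_, hposv x.1 hx.1 x.2 ?_, fun y hy => hmin hy⟩
      rintro h0
      have := hx.2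
      simp [h0] at this
  refine ⟨c, hc, fun t ht v => ?_⟩
  rcases eq_or_ne v 0 with rfl | hv
  · simp
  · have hvv : 0 < v ⬝ᵥ v := by
      have := dotProduct_star_self_pos_iff.2 hv
      simpa using this
    have hs : 0 < Real.sqrt (v ⬝ᵥ v) := Real.sqrt_pos.2 hvv
    have hss := Real.mul_self_sqrt hvv.le
    have := hle (t, (Real.sqrt (v ⬝ᵥ v))⁻¹ • v) ⟨ht, by
      simp only [mem_ofPred_eq, dotProduct_smul, smul_dotProduct, smul_eq_mul]
      nth_rewrite 3 [← hss]
      field_simp⟩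
    simp only [mulVec_smul, dotProduct_smul, smul_dotProduct, smul_eq_mul] at this
    rw [← mul_assoc, ← mul_inv, hss, inv_mul_eq_div, le_div_iff₀ hvv] at this
    exact this

/-- Integration by parts for two primitives, one vanishing at each end point. -/
lemma integral_primitive_mul_eq {a b : ℝ} {f g : ℝ → ℝ}
    (hf : IntervalIntegrable f volume a b) (hg : IntervalIntegrable g volume a b) :
    ∫ t in a..b, (∫ s in a..t, f s) * g t = ∫ t in a..b, f t * ∫ s in t..b, g s := by
  have hF := hf.absolutelyContinuousOnInterval_intervalIntegral (c := a) left_mem_uIcc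
  have hG := hg.absolutelyContinuousOnInterval_intervalIntegral (c := b) right_mem_uIcc
  have hibp := hF.integral_mul_deriv_eq_deriv_mul hG
  have hl : ∫ t in a..b, (∫ s in a..t, f s) * deriv (fun x => ∫ v in b..x, g v) t
      = ∫ t in a..b, (∫ s in a..t, f s) * g t := by
    refine intervalIntegral.integral_congr_ae ?_
    filter_upwards [hg.ae_hasDerivAt_integral] with t ht htm
    rw [(ht (uIoc_subset_uIcc htm) b right_mem_uIcc).deriv]
  have hr : ∫ t in a..b, deriv (fun x => ∫ v in a..x, f v) t * (∫ s in b..t, g s)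
      = ∫ t in a..b, -(f t * ∫ s in t..b, g s) := by
    refine intervalIntegral.integral_congr_ae ?_
    filter_upwards [hf.ae_hasDerivAt_integral] with t ht htm
    rw [(ht (uIoc_subset_uIcc htm) a left_mem_uIcc).deriv,
      intervalIntegral.integral_symm t b, mul_neg]
  rw [hl, hr] at hibp
  simpa using hibp

lemma ae_eq_zero_of_primitive_eq_zero {a b : ℝ} (hab : a ≤ b) {f : ℝ → ℝ}
    (hf : IntervalIntegrable f volume a b) (h0 : ∀ t ∈ Icc a b, ∫ s in a..t, f s = 0) :
    ∀ᵐ t ∂(volume.restrict (Icc a b)), f t = 0 := by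
  rw [Measure.restrict_congr_set Ioo_ae_eq_Icc.symm, ae_restrict_iff' measurableSet_Ioo]
  filter_upwards [hf.ae_hasDerivAt_integral] with t ht htm
  have h1 := ht (by rw [uIcc_of_le hab]; exact Ioo_subset_Icc_self htm) a left_mem_uIcc
  have h2 : (fun x => ∫ s in a..x, f s) =ᶠ[𝓝 t] fun _ => 0 := by
    filter_upwards [Ioo_mem_nhds htm.1 htm.2] with x hx using h0 x (Ioo_subset_Icc_self hx)
  exact (h1.congr_of_eventuallyEq h2.symm).unique (hasDerivAt_const t 0)

lemma memLp_intervalIntegrable {k : ℕ} {a b : ℝ} (hab : a ≤ b) {f : ℝ → Fin k → ℝ}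
    (hf : MemLp f 2 (volume.restrict (Icc a b))) : IntervalIntegrable f volume a b := by
  rw [intervalIntegrable_iff_integrableOn_Icc_of_le hab]
  exact hf.integrable one_le_two

lemma intervalIntegrable_of_mem_Icc {k : ℕ} {a b c d : ℝ} {f : ℝ → Fin k → ℝ}
    (hf : MemLp f 2 (volume.restrict (Icc a b))) (hc : c ∈ Icc a b) (hd : d ∈ Icc a b) :
    IntervalIntegrable f volume c d := by
  have hab : a ≤ b := hc.1.trans hc.2
  refine (memLp_intervalIntegrable hab hf).mono_set ?_
  rw [uIcc_of_le hab]
  exact uIcc_subset_Icc hc hd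

lemma intervalIntegral_apply {k : ℕ} {c d : ℝ} {f : ℝ → Fin k → ℝ}
    (hf : IntervalIntegrable f volume c d) (i : Fin k) :
    (∫ s in c..d, f s) i = ∫ s in c..d, f s i :=
  ((ContinuousLinearMap.proj (R := ℝ) (φ := fun _ : Fin k => ℝ) i).intervalIntegral_comp_comm
    hf).symm

lemma mulVec_intervalIntegral {k l : ℕ} {c d : ℝ} (M : Matrix (Fin l) (Fin k) ℝ)
    {f : ℝ → Fin k → ℝ} (hf : IntervalIntegrable f volume c d) :
    M *ᵥ (∫ s in c..d, f s) = ∫ s in c..d, M *ᵥ f s :=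
  ((LinearMap.toContinuousLinearMap M.mulVecLin).intervalIntegral_comp_comm hf).symm

lemma intervalIntegrable_apply {k : ℕ} {c d : ℝ} {f : ℝ → Fin k → ℝ}
    (hf : IntervalIntegrable f volume c d) (i : Fin k) :
    IntervalIntegrable (fun t => f t i) volume c d :=
  ⟨hf.1.eval i, hf.2.eval i⟩

lemma memLp_const_mulVec {k l : ℕ} {a b : ℝ} (M : Matrix (Fin k) (Fin l) ℝ) {x : ℝ → Fin l → ℝ}
    (hx : MemLp x 2 (volume.restrict (Icc a b))) :
    MemLp (fun t => M *ᵥ x t) 2 (volume.restrict (Icc a b)) :=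
  memLp_mulVec continuousOn_const hx

lemma continuousOn_primitive_left {k : ℕ} {a b : ℝ} (hab : a ≤ b) {f : ℝ → Fin k → ℝ}
    (hf : MemLp f 2 (volume.restrict (Icc a b))) :
    ContinuousOn (fun t => ∫ s in a..t, f s) (Icc a b) := by
  rw [← uIcc_of_le hab]
  exact intervalIntegral.continuousOn_primitive_interval' (memLp_intervalIntegrable hab hf)
    left_mem_uIcc

lemma continuousOn_primitive_right {k : ℕ} {a b : ℝ} (hab : a ≤ b) {f : ℝ → Fin k → ℝ}
    (hf : MemLp f 2 (volume.restrict (Icc a b))) :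
    ContinuousOn (fun t => ∫ s in t..b, f s) (Icc a b) := by
  simp_rw [intervalIntegral.integral_symm b]
  rw [← uIcc_of_le hab]
  exact (intervalIntegral.continuousOn_primitive_interval' (memLp_intervalIntegrable hab hf)
    right_mem_uIcc).neg

lemma integral_primitive_dotProduct_eq {k : ℕ} {a b : ℝ} (hab : a ≤ b) {f g : ℝ → Fin k → ℝ}
    (hf : MemLp f 2 (volume.restrict (Icc a b))) (hg : MemLp g 2 (volume.restrict (Icc a b))) :
    ∫ t in a..b, (∫ s in a..t, f s) ⬝ᵥ g t = ∫ t in a..b, f t ⬝ᵥ ∫ s in t..b, g s := by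
  have hFc := memLp_of_continuousOn_Icc (continuousOn_primitive_left hab hf) 2
  have hGc := memLp_of_continuousOn_Icc (continuousOn_primitive_right hab hg) 2
  have hmul : ∀ {x y : ℝ → Fin k → ℝ}, MemLp x 2 (volume.restrict (Icc a b)) →
      MemLp y 2 (volume.restrict (Icc a b)) → ∀ i,
      IntervalIntegrable (fun t => x t i * y t i) volume a b := by
    intro x y hx hy i
    rw [intervalIntegrable_iff_integrableOn_Icc_of_le hab]
    exact (hx.eval i).integrable_mul (hy.eval i)
  simp only [dotProduct]
  rw [intervalIntegral.integral_finsetSum fun i _ => hmul hFc hg i,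
    intervalIntegral.integral_finsetSum fun i _ => hmul hf hGc i]
  refine Finset.sum_congr rfl fun i _ => ?_
  have h1 : ∫ t in a..b, (∫ s in a..t, f s) i * g t i
      = ∫ t in a..b, (∫ s in a..t, f s i) * g t i := by
    refine intervalIntegral.integral_congr fun t ht => ?_
    rw [uIcc_of_le hab] at ht
    simp only [intervalIntegral_apply
      (intervalIntegrable_of_mem_Icc hf (left_mem_Icc.2 hab) ht) i]
  have h2 : ∫ t in a..b, f t i * (∫ s in t..b, g s) i
      = ∫ t in a..b, f t i * ∫ s in t..b, g s i := by
    refine intervalIntegral.integral_congr fun t ht => ?_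
    rw [uIcc_of_le hab] at ht
    simp only [intervalIntegral_apply
      (intervalIntegrable_of_mem_Icc hg ht (right_mem_Icc.2 hab)) i]
  rw [h1, h2]
  exact integral_primitive_mul_eq
    (intervalIntegrable_apply (memLp_intervalIntegrable hab hf) i)
    (intervalIntegrable_apply (memLp_intervalIntegrable hab hg) i)

lemma integral_dotProduct_const {k : ℕ} {μ : Measure ℝ} {f : ℝ → Fin k → ℝ}
    (hf : Integrable f μ) (x : Fin k → ℝ) : ∫ t, f t ⬝ᵥ x ∂μ = (∫ t, f t ∂μ) ⬝ᵥ x := by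
  simp only [dotProduct]
  rw [integral_finsetSum _ fun i _ => (hf.eval i).mul_const _]
  refine Finset.sum_congr rfl fun i _ => ?_
  rw [integral_mul_const, eval_integral fun j => hf.eval j]

lemma ae_mulVec_eq_zero_of_primitive {k l : ℕ} {a b : ℝ} (hab : a ≤ b)
    (M : Matrix (Fin l) (Fin k) ℝ) {f : ℝ → Fin k → ℝ}
    (hf : MemLp f 2 (volume.restrict (Icc a b)))
    (h0 : ∀ t ∈ Icc a b, M *ᵥ (∫ s in a..t, f s) = 0) :
    ∀ᵐ t ∂(volume.restrict (Icc a b)), M *ᵥ f t = 0 := by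
  have hMf := memLp_const_mulVec M hf
  have hi : ∀ i, ∀ᵐ t ∂(volume.restrict (Icc a b)), (M *ᵥ f t) i = 0 := by
    intro i
    refine ae_eq_zero_of_primitive_eq_zero hab
      (intervalIntegrable_apply (memLp_intervalIntegrable hab hMf) i) fun t ht => ?_
    rw [← intervalIntegral_apply (intervalIntegrable_of_mem_Icc hMf (left_mem_Icc.2 hab) ht) i,
      ← mulVec_intervalIntegral M (intervalIntegrable_of_mem_Icc hf (left_mem_Icc.2 hab) ht),
      h0 t ht, Pi.zero_apply]
  filter_upwards [ae_all_iff.2 hi] with t ht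
  exact funext ht

lemma IsMoorePenrose.proj_mulVec_transpose {m n : ℕ} {F : Matrix (Fin m) (Fin n) ℝ}
    {Fplus : Matrix (Fin n) (Fin m) ℝ} (h : IsMoorePenrose F Fplus) (y : Fin m → ℝ) :
    (Fplus * F) *ᵥ (Fᵀ *ᵥ y) = Fᵀ *ᵥ y := by
  rw [mulVec_mulVec, ← h.2.2.2, ← transpose_mul, ← Matrix.mul_assoc, h.1]

/-- Green's formula for the pair of mutually adjoint descriptor operators. -/
lemma green_formula {m n : ℕ} {a b : ℝ} (hab : a ≤ b) {F : Matrix (Fin m) (Fin n) ℝ}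
    {Fplus : Matrix (Fin n) (Fin m) ℝ} (hF : IsMoorePenrose F Fplus)
    {x β : ℝ → Fin n → ℝ} {y α : ℝ → Fin m → ℝ} {b0 : Fin n → ℝ}
    (hα : MemLp α 2 (volume.restrict (Icc a b))) (hβ : MemLp β 2 (volume.restrict (Icc a b)))
    (hFx : ∀ t ∈ Icc a b, F *ᵥ x t = ∫ s in a..t, α s)
    (hFy : ∀ t ∈ Icc a b, Fᵀ *ᵥ y t = b0 - ∫ s in t..b, β s) :
    (∫ t, α t ⬝ᵥ y t ∂(volume.restrict (Icc a b)))
      + ∫ t, x t ⬝ᵥ β t ∂(volume.restrict (Icc a b)) = (Fplus *ᵥ (F *ᵥ x b)) ⬝ᵥ b0 := by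
  have hαr : ∀ᵐ t ∂(volume.restrict (Icc a b)), F *ᵥ (Fplus *ᵥ α t) = α t := by
    have := ae_mulVec_eq_zero_of_primitive hab (1 - F * Fplus) hα fun t ht => by
      rw [← hFx t ht, mulVec_mulVec, Matrix.sub_mul, hF.1, Matrix.one_mul, sub_self, zero_mulVec]
    filter_upwards [this] with t ht
    rw [sub_mulVec, one_mulVec, sub_eq_zero] at ht
    rw [mulVec_mulVec, ← ht]
  have hβr : ∀ᵐ t ∂(volume.restrict (Icc a b)), (Fplus * F) *ᵥ β t = β t := by
    have := ae_mulVec_eq_zero_of_primitive hab (1 - Fplus * F) hβ fun t ht => by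
      have hsplit : ∫ s in a..t, β s = Fᵀ *ᵥ y t - Fᵀ *ᵥ y a := by
        rw [hFy t ht, hFy a (left_mem_Icc.2 hab), ← intervalIntegral.integral_add_adjacent_intervals
          (intervalIntegrable_of_mem_Icc hβ (left_mem_Icc.2 hab) ht)
          (intervalIntegrable_of_mem_Icc hβ ht (right_mem_Icc.2 hab))]
        abel
      rw [hsplit, sub_mulVec, one_mulVec, mulVec_sub, hF.proj_mulVec_transpose,
        hF.proj_mulVec_transpose, sub_self]
    filter_upwards [this] with t ht
    rw [sub_mulVec, one_mulVec, sub_eq_zero] at ht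
    exact ht.symm
  have hFα := memLp_const_mulVec Fplus hα
  have hprim : ∀ t ∈ Icc a b, ∫ s in a..t, Fplus *ᵥ α s = (Fplus * F) *ᵥ x t := by
    intro t ht
    rw [← mulVec_intervalIntegral _ (intervalIntegrable_of_mem_Icc hα (left_mem_Icc.2 hab) ht),
      ← hFx t ht, mulVec_mulVec]
  have hBc := memLp_of_continuousOn_Icc (continuousOn_primitive_right hab hβ) 2
  have hb0 : MemLp (fun _ : ℝ => b0) 2 (volume.restrict (Icc a b)) :=
    memLp_of_continuousOn_Icc continuousOn_const 2
  have h1 : ∫ t, α t ⬝ᵥ y t ∂(volume.restrict (Icc a b))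
      = ∫ t, ((Fplus *ᵥ α t) ⬝ᵥ b0 - (Fplus *ᵥ α t) ⬝ᵥ ∫ s in t..b, β s)
        ∂(volume.restrict (Icc a b)) := by
    refine integral_congr_ae ?_
    filter_upwards [hαr, ae_restrict_mem measurableSet_Icc] with t ht htm
    rw [← dotProduct_sub, ← hFy t htm, dotProduct_mulVec, vecMul_transpose, ht]
  have h2 : ∫ t, (Fplus *ᵥ α t) ⬝ᵥ b0 ∂(volume.restrict (Icc a b))
      = (Fplus *ᵥ (F *ᵥ x b)) ⬝ᵥ b0 := by
    rw [mulVec_mulVec, ← hprim b (right_mem_Icc.2 hab),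
      intervalIntegral_eq_integral_restrict_Icc hab]
    exact integral_dotProduct_const (hFα.integrable one_le_two) b0
  have h3 : ∫ t, (Fplus *ᵥ α t) ⬝ᵥ (∫ s in t..b, β s) ∂(volume.restrict (Icc a b))
      = ∫ t, x t ⬝ᵥ β t ∂(volume.restrict (Icc a b)) := by
    rw [← intervalIntegral_eq_integral_restrict_Icc hab,
      ← integral_primitive_dotProduct_eq hab hFα hβ,
      intervalIntegral_eq_integral_restrict_Icc hab]
    refine integral_congr_ae ?_
    filter_upwards [hβr, ae_restrict_mem measurableSet_Icc] with t ht htm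
    rw [hprim t htm]
    nth_rewrite 2 [← ht]
    rw [dotProduct_mulVec, ← hF.2.2.2, vecMul_transpose, hF.2.2.2]
  rw [h1, integral_sub (integrable_dotProduct hFα hb0) (integrable_dotProduct hFα hBc), h2, h3]
  ring

lemma memLp_transpose_mulVec {k l : ℕ} {a b : ℝ} {A : ℝ → Matrix (Fin k) (Fin l) ℝ}
    (hA : ContinuousOn A (Icc a b)) {x : ℝ → Fin k → ℝ}
    (hx : MemLp x 2 (volume.restrict (Icc a b))) :
    MemLp (fun t => (A t)ᵀ *ᵥ x t) 2 (volume.restrict (Icc a b)) :=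
  memLp_mulVec (A := fun t => (A t)ᵀ) (continuous_id.matrix_transpose.comp_continuousOn hA) hx

lemma memLp_adjoint_integrand {m n p : ℕ} {a b : ℝ}
    {C : ℝ → Matrix (Fin m) (Fin n) ℝ} (hC : ContinuousOn C (Icc a b))
    {H : ℝ → Matrix (Fin p) (Fin n) ℝ} (hH : ContinuousOn H (Icc a b))
    {v : ℝ → Fin p → ℝ} (hv : MemLp v 2 (volume.restrict (Icc a b)))
    {y : ℝ → Fin m → ℝ} (hy : MemLp y 2 (volume.restrict (Icc a b))) :
    MemLp (fun s => -((C s)ᵀ *ᵥ y s) + (H s)ᵀ *ᵥ v s) 2 (volume.restrict (Icc a b)) :=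
  (memLp_transpose_mulVec hC hy).neg.add (memLp_transpose_mulVec hH hv)

/-- Pairing of `(v, y)` with the test function `(H r, F ρ - C r)`, where `r` is the primitive
of `ρ`. -/
lemma integral_test_eq {m n p : ℕ} {a b : ℝ} (hab : a ≤ b) {F : Matrix (Fin m) (Fin n) ℝ}
    {C : ℝ → Matrix (Fin m) (Fin n) ℝ} (hC : ContinuousOn C (Icc a b))
    {H : ℝ → Matrix (Fin p) (Fin n) ℝ} (hH : ContinuousOn H (Icc a b))
    {ρ : ℝ → Fin n → ℝ} (hρ : MemLp ρ 2 (volume.restrict (Icc a b)))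
    {v : ℝ → Fin p → ℝ} (hv : MemLp v 2 (volume.restrict (Icc a b)))
    {y : ℝ → Fin m → ℝ} (hy : MemLp y 2 (volume.restrict (Icc a b))) :
    ∫ t, ((H t *ᵥ ∫ s in a..t, ρ s) ⬝ᵥ v t + (F *ᵥ ρ t - C t *ᵥ ∫ s in a..t, ρ s) ⬝ᵥ y t)
        ∂(volume.restrict (Icc a b))
      = ∫ t, ρ t ⬝ᵥ (Fᵀ *ᵥ y t + ∫ s in t..b, (-((C s)ᵀ *ᵥ y s) + (H s)ᵀ *ᵥ v s))
        ∂(volume.restrict (Icc a b)) := by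
  have hγ := memLp_adjoint_integrand hC hH hv hy
  have hr := memLp_of_continuousOn_Icc (continuousOn_primitive_left hab hρ) 2
  have hΓ := memLp_of_continuousOn_Icc (continuousOn_primitive_right hab hγ) 2
  have hFy := memLp_const_mulVec Fᵀ hy
  simp only [dotProduct_add]
  rw [integral_add (integrable_dotProduct hρ hFy) (integrable_dotProduct hρ hΓ),
    ← intervalIntegral_eq_integral_restrict_Icc hab (fun t => ρ t ⬝ᵥ ∫ s in t..b, _),
    ← integral_primitive_dotProduct_eq hab hρ hγ, intervalIntegral_eq_integral_restrict_Icc hab,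
    ← integral_add (integrable_dotProduct hρ hFy) (integrable_dotProduct hr hγ)]
  refine integral_congr_ae (Eventually.of_forall fun t => ?_)
  simp only [dotProduct_add, dotProduct_neg, dotProduct_mulVec, vecMul_transpose, sub_dotProduct]
  ring

lemma dotProduct_mulVec_symm {k : ℕ} {A : Matrix (Fin k) (Fin k) ℝ} (hA : A.PosDef)
    (x y : Fin k → ℝ) : (A *ᵥ x) ⬝ᵥ y = (A *ᵥ y) ⬝ᵥ x := by
  have hs : Aᵀ = A := by simpa using hA.isHermitian.eq
  rw [dotProduct_comm, dotProduct_mulVec, ← mulVec_transpose, hs]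

lemma integral_quadratic_add_smul {k : ℕ} {a b : ℝ} {A : ℝ → Matrix (Fin k) (Fin k) ℝ}
    (hA : ContinuousOn A (Icc a b)) (hpd : ∀ t ∈ Icc a b, (A t).PosDef) {x y : ℝ → Fin k → ℝ}
    (hx : MemLp x 2 (volume.restrict (Icc a b))) (hy : MemLp y 2 (volume.restrict (Icc a b)))
    (r : ℝ) :
    ∫ t, (A t *ᵥ (x t + r • y t)) ⬝ᵥ (x t + r • y t) ∂(volume.restrict (Icc a b))
      = ∫ t, (A t *ᵥ x t) ⬝ᵥ x t ∂(volume.restrict (Icc a b))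
        + 2 * r * ∫ t, (A t *ᵥ x t) ⬝ᵥ y t ∂(volume.restrict (Icc a b))
        + r ^ 2 * ∫ t, (A t *ᵥ y t) ⬝ᵥ y t ∂(volume.restrict (Icc a b)) := by
  have hxx := integrable_dotProduct (memLp_mulVec hA hx) hx
  have hxy := integrable_dotProduct (memLp_mulVec hA hx) hy
  have hyy := integrable_dotProduct (memLp_mulVec hA hy) hy
  rw [← integral_const_mul, ← integral_const_mul, ← integral_add hxx (hxy.const_mul _),
    ← integral_add (hxx.fun_add (hxy.const_mul _)) (hyy.const_mul _)]
  refine integral_congr_ae ?_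
  filter_upwards [ae_restrict_mem measurableSet_Icc] with t ht
  simp only [mulVec_add, mulVec_smul, dotProduct_add, add_dotProduct, dotProduct_smul,
    smul_dotProduct, smul_eq_mul, dotProduct_mulVec_symm (hpd t ht) (y t) (x t)]
  ring

lemma eq_zero_of_forall_quadratic_nonneg {B D : ℝ} (h : ∀ r : ℝ, 0 ≤ 2 * r * B + r ^ 2 * D) :
    B = 0 := by
  have hD : 0 < |D| + 1 := by positivity
  have h1 := h (-B / (|D| + 1))
  have h2 : 2 * (-B / (|D| + 1)) * B + (-B / (|D| + 1)) ^ 2 * D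
      = B ^ 2 * (D - 2 * (|D| + 1)) / (|D| + 1) ^ 2 := by
    field_simp; ring
  rw [h2, le_div_iff₀ (by positivity), zero_mul] at h1
  have h3 : D - 2 * (|D| + 1) ≤ -2 := by linarith [le_abs_self D, abs_nonneg D]
  have h4 : B ^ 2 ≤ 0 := by nlinarith [sq_nonneg B]
  exact pow_eq_zero_iff two_ne_zero |>.1 (le_antisymm h4 (sq_nonneg B))

lemma sq_norm_le_dotProduct {k : ℕ} (v : Fin k → ℝ) : ‖v‖ ^ 2 ≤ v ⬝ᵥ v := by
  have h0 : 0 ≤ v ⬝ᵥ v := Finset.sum_nonneg fun i _ => mul_self_nonneg (v i)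
  refine (Real.le_sqrt (norm_nonneg v) h0).1
    ((pi_norm_le_iff_of_nonneg (Real.sqrt_nonneg _)).2 fun i => ?_)
  refine Real.abs_le_sqrt ?_
  rw [sq]
  exact Finset.single_le_sum (f := fun i => v i * v i) (fun j _ => mul_self_nonneg (v j))
    (Finset.mem_univ i)

/-- An almost everywhere solution of the homogeneous adjoint DAE has a representative that solves
it everywhere. -/
lemma exists_ae_eq_homogeneous_adjoint {m n p : ℕ} {a b : ℝ} (hab : a < b)
    {F : Matrix (Fin m) (Fin n) ℝ} {Fplus : Matrix (Fin n) (Fin m) ℝ}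
    (hF : IsMoorePenrose F Fplus)
    {C : ℝ → Matrix (Fin m) (Fin n) ℝ} (hC : ContinuousOn C (Icc a b))
    {H : ℝ → Matrix (Fin p) (Fin n) ℝ} (hH : ContinuousOn H (Icc a b))
    {v : ℝ → Fin p → ℝ} (hv : MemLp v 2 (volume.restrict (Icc a b)))
    {y : ℝ → Fin m → ℝ} (hy : MemLp y 2 (volume.restrict (Icc a b)))
    (h0 : ∀ᵐ t ∂(volume.restrict (Icc a b)),
      Fᵀ *ᵥ y t + ∫ s in t..b, (-((C s)ᵀ *ᵥ y s) + (H s)ᵀ *ᵥ v s) = 0) :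
    ∃ y' : ℝ → Fin m → ℝ, y' =ᵐ[volume.restrict (Icc a b)] y ∧ ∀ t ∈ Icc a b,
      Fᵀ *ᵥ y' t = -∫ s in t..b, (-((C s)ᵀ *ᵥ y' s) + (H s)ᵀ *ᵥ v s) := by
  classical
  set Γ : ℝ → Fin n → ℝ := fun t => ∫ s in t..b, (-((C s)ᵀ *ᵥ y s) + (H s)ᵀ *ᵥ v s) with hΓ
  have hΓc : ContinuousOn Γ (Icc a b) :=
    continuousOn_primitive_right hab.le (memLp_adjoint_integrand hC hH hv hy)
  have hproj : EqOn (fun t => (Fplus * F) *ᵥ Γ t) Γ (Icc a b) := by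
    refine Measure.eqOn_Icc_of_ae_eq volume hab.ne ?_ ?_ hΓc
    · filter_upwards [h0] with t ht
      have : Γ t = Fᵀ *ᵥ (-y t) := by rw [mulVec_neg, eq_neg_iff_add_eq_zero, add_comm]; exact ht
      rw [this, hF.proj_mulVec_transpose]
    · exact (Continuous.matrix_mulVec continuous_const continuous_id).comp_continuousOn hΓc
  let y' : ℝ → Fin m → ℝ := fun t =>
    if Fᵀ *ᵥ y t + Γ t = 0 then y t else Fplusᵀ *ᵥ (-Γ t)
  have hae : y' =ᵐ[volume.restrict (Icc a b)] y := by
    filter_upwards [h0] with t ht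
    exact if_pos ht
  refine ⟨y', hae, fun t ht => ?_⟩
  have hint : ∫ s in t..b, (-((C s)ᵀ *ᵥ y' s) + (H s)ᵀ *ᵥ v s) = Γ t := by
    refine intervalIntegral.integral_congr_ae ?_
    filter_upwards [(ae_restrict_iff' measurableSet_Icc).1 hae] with s hs hst
    rw [uIoc_of_le ht.2] at hst
    rw [hs ⟨ht.1.trans hst.1.le, hst.2⟩]
  rw [hint]
  by_cases hc : Fᵀ *ᵥ y t + Γ t = 0
  · simp only [y', if_pos hc]
    exact eq_neg_of_add_eq_zero_left hc
  · simp only [y', if_neg hc]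
    rw [mulVec_mulVec, ← transpose_mul, hF.2.2.2, mulVec_neg]
    exact congrArg Neg.neg (hproj ht)

/-- First order optimality condition for the quadratic minimization problem. -/
lemma integral_eq_zero_of_homogeneous_adjoint {m n p : ℕ} {a b : ℝ} (hab : a < b)
    {F : Matrix (Fin m) (Fin n) ℝ} {Fplus : Matrix (Fin n) (Fin m) ℝ}
    (hF : IsMoorePenrose F Fplus)
    {C : ℝ → Matrix (Fin m) (Fin n) ℝ} (hC : ContinuousOn C (Icc a b))
    {H : ℝ → Matrix (Fin p) (Fin n) ℝ} (hH : ContinuousOn H (Icc a b))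
    {A : ℝ → Matrix (Fin m) (Fin m) ℝ} (hA : ContinuousOn A (Icc a b))
    (hApd : ∀ t ∈ Icc a b, (A t).PosDef)
    {B : ℝ → Matrix (Fin p) (Fin p) ℝ} (hB : ContinuousOn B (Icc a b))
    (hBpd : ∀ t ∈ Icc a b, (B t).PosDef) {ℓ : Fin m → ℝ}
    {uhat : ℝ → Fin p → ℝ} {zhat : ℝ → Fin m → ℝ}
    (huhat : L2On a b uhat) (hzhat : SolvesAdjoint a b F C H uhat ℓ zhat)
    (hmin : ∀ (u : ℝ → (Fin p → ℝ)) (z : ℝ → (Fin m → ℝ)),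
      L2On a b u → SolvesAdjoint a b F C H u ℓ z →
        (∫ t in a..b, (A t *ᵥ zhat t) ⬝ᵥ zhat t) + (∫ t in a..b, (B t *ᵥ uhat t) ⬝ᵥ uhat t) ≤
          (∫ t in a..b, (A t *ᵥ z t) ⬝ᵥ z t) + (∫ t in a..b, (B t *ᵥ u t) ⬝ᵥ u t))
    {v : ℝ → Fin p → ℝ} (hv : MemLp v 2 (volume.restrict (Icc a b)))
    {y : ℝ → Fin m → ℝ} (hy : MemLp y 2 (volume.restrict (Icc a b)))
    (h0 : ∀ᵐ t ∂(volume.restrict (Icc a b)),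
      Fᵀ *ᵥ y t + ∫ s in t..b, (-((C s)ᵀ *ᵥ y s) + (H s)ᵀ *ᵥ v s) = 0) :
    ∫ t, ((B t *ᵥ uhat t) ⬝ᵥ v t + (A t *ᵥ zhat t) ⬝ᵥ y t) ∂(volume.restrict (Icc a b)) = 0 := by
  obtain ⟨y', hae, hy'⟩ := exists_ae_eq_homogeneous_adjoint hab hF hC hH hv hy h0
  have hyL : MemLp y' 2 (volume.restrict (Icc a b)) := (memLp_congr_ae hae).2 hy
  have hu := l2On_iff_memLp.1 huhat
  have hz := l2On_iff_memLp.1 hzhat.1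
  have hsol : ∀ r : ℝ, SolvesAdjoint a b F C H (fun t => uhat t + r • v t) ℓ
      (fun t => zhat t + r • y' t) := by
    intro r
    refine ⟨l2On_iff_memLp.2 (hz.add (hyL.const_smul r)), fun t ht => ?_⟩
    have hi1 := intervalIntegrable_of_mem_Icc (memLp_adjoint_integrand hC hH hu hz) ht
      (right_mem_Icc.2 hab.le)
    have hi2 := intervalIntegrable_of_mem_Icc (memLp_adjoint_integrand hC hH hv hyL) ht
      (right_mem_Icc.2 hab.le)
    have hsum : ∫ s in t..b, (-((C s)ᵀ *ᵥ (zhat s + r • y' s)) + (H s)ᵀ *ᵥ (uhat s + r • v s))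
        = (∫ s in t..b, (-((C s)ᵀ *ᵥ zhat s) + (H s)ᵀ *ᵥ uhat s))
          + r • ∫ s in t..b, (-((C s)ᵀ *ᵥ y' s) + (H s)ᵀ *ᵥ v s) := by
      rw [← intervalIntegral.integral_smul]
      refine Eq.trans ?_ (intervalIntegral.integral_add hi1 (hi2.smul r))
      refine intervalIntegral.integral_congr fun s _ => ?_
      simp only [mulVec_add, mulVec_smul, smul_add, smul_neg]
      abel
    rw [hsum, mulVec_add, mulVec_smul, hzhat.2 t ht, hy' t ht, smul_neg]
    abel
  have hquad : ∀ r : ℝ, 0 ≤ 2 * r *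
      (∫ t, (B t *ᵥ uhat t) ⬝ᵥ v t ∂(volume.restrict (Icc a b))
        + ∫ t, (A t *ᵥ zhat t) ⬝ᵥ y' t ∂(volume.restrict (Icc a b)))
      + r ^ 2 * (∫ t, (B t *ᵥ v t) ⬝ᵥ v t ∂(volume.restrict (Icc a b))
        + ∫ t, (A t *ᵥ y' t) ⬝ᵥ y' t ∂(volume.restrict (Icc a b))) := by
    intro r
    have h := hmin _ _ (l2On_iff_memLp.2 (hu.add (hv.const_smul r))) (hsol r)
    simp only [intervalIntegral_eq_integral_restrict_Icc hab.le, Pi.add_apply, Pi.smul_apply] at h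
    rw [integral_quadratic_add_smul hA hApd hz hyL, integral_quadratic_add_smul hB hBpd hu hv] at h
    linarith
  rw [integral_add (integrable_dotProduct (memLp_mulVec hB hu) hv)
    (integrable_dotProduct (memLp_mulVec hA hz) hy), ← eq_zero_of_forall_quadratic_nonneg hquad]
  congr 1
  refine integral_congr_ae ?_
  filter_upwards [hae] with t ht
  rw [ht]

/-- The difference of a solution of the Euler–Lagrange system and a solution of the adjoint DAE. -/
lemma SolvesEL.sub_adjoint {m n p : ℕ} {a b : ℝ} (hab : a ≤ b)
    {F : Matrix (Fin m) (Fin n) ℝ} {Fplus : Matrix (Fin n) (Fin m) ℝ}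
    {C : ℝ → Matrix (Fin m) (Fin n) ℝ} (hC : ContinuousOn C (Icc a b))
    {H : ℝ → Matrix (Fin p) (Fin n) ℝ} (hH : ContinuousOn H (Icc a b))
    {Q : ℝ → Matrix (Fin m) (Fin m) ℝ}
    {R : ℝ → Matrix (Fin p) (Fin p) ℝ} (hR : ContinuousOn R (Icc a b))
    {ε : ℝ} {ℓ : Fin m → ℝ} {pe : ℝ → Fin n → ℝ} {z : ℝ → Fin m → ℝ}
    (hEL : SolvesEL a b F Fplus C H Q R ε ℓ pe z)
    {uhat : ℝ → Fin p → ℝ} {zhat : ℝ → Fin m → ℝ}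
    (huhat : L2On a b uhat) (hzhat : SolvesAdjoint a b F C H uhat ℓ zhat) {t : ℝ}
    (ht : t ∈ Icc a b) :
    Fᵀ *ᵥ (z t - zhat t) = -(Fplus *ᵥ (F *ᵥ pe b)) - ∫ s in t..b,
      (-((C s)ᵀ *ᵥ (z s - zhat s))
        + (H s)ᵀ *ᵥ ((1 / ε) • (R s *ᵥ (H s *ᵥ pe s)) - uhat s) + pe s) := by
  obtain ⟨hp, hz, -, hadj⟩ := hEL
  rw [l2On_iff_memLp] at hp hz huhat
  have hzh := l2On_iff_memLp.1 hzhat.1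
  have hu : MemLp (fun s => (1 / ε) • (R s *ᵥ (H s *ᵥ pe s))) 2 (volume.restrict (Icc a b)) :=
    (memLp_mulVec hR (memLp_mulVec hH hp)).const_smul (1 / ε)
  have hi1 := intervalIntegrable_of_mem_Icc ((memLp_adjoint_integrand hC hH hu hz).add hp) ht
    (right_mem_Icc.2 hab)
  have hi2 := intervalIntegrable_of_mem_Icc (memLp_adjoint_integrand hC hH huhat hzh) ht
    (right_mem_Icc.2 hab)
  have hsub : ∫ s in t..b, (-((C s)ᵀ *ᵥ (z s - zhat s))
        + (H s)ᵀ *ᵥ ((1 / ε) • (R s *ᵥ (H s *ᵥ pe s)) - uhat s) + pe s)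
      = (∫ s in t..b, (-((C s)ᵀ *ᵥ z s)
          + (H s)ᵀ *ᵥ ((1 / ε) • (R s *ᵥ (H s *ᵥ pe s))) + pe s))
        - ∫ s in t..b, (-((C s)ᵀ *ᵥ zhat s) + (H s)ᵀ *ᵥ uhat s) := by
    refine Eq.trans ?_ (intervalIntegral.integral_sub hi1 hi2)
    refine intervalIntegral.integral_congr fun s _ => ?_
    simp only [mulVec_sub]
    abel
  rw [hsub, mulVec_sub, hadj t ht, hzhat.2 t ht]
  abel

/-- Energy identity of the Euler–Lagrange system relative to a solution of the adjoint DAE. -/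
lemma SolvesEL.energy_identity {m n p : ℕ} {a b : ℝ} (hab : a ≤ b)
    {F : Matrix (Fin m) (Fin n) ℝ} {Fplus : Matrix (Fin n) (Fin m) ℝ}
    (hF : IsMoorePenrose F Fplus)
    {C : ℝ → Matrix (Fin m) (Fin n) ℝ} (hC : ContinuousOn C (Icc a b))
    {H : ℝ → Matrix (Fin p) (Fin n) ℝ} (hH : ContinuousOn H (Icc a b))
    {Q : ℝ → Matrix (Fin m) (Fin m) ℝ} (hQ : ContinuousOn Q (Icc a b))
    (hQpd : ∀ t ∈ Icc a b, (Q t).PosDef)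
    {R : ℝ → Matrix (Fin p) (Fin p) ℝ} (hR : ContinuousOn R (Icc a b))
    (hRpd : ∀ t ∈ Icc a b, (R t).PosDef)
    {ε : ℝ} (hε : 0 < ε) {ℓ : Fin m → ℝ} {pe : ℝ → Fin n → ℝ} {z : ℝ → Fin m → ℝ}
    (hEL : SolvesEL a b F Fplus C H Q R ε ℓ pe z)
    {uhat : ℝ → Fin p → ℝ} {zhat : ℝ → Fin m → ℝ}
    (huhat : L2On a b uhat) (hzhat : SolvesAdjoint a b F C H uhat ℓ zhat)
    {v : ℝ → Fin p → ℝ} (hv : v = fun t => (1 / ε) • (R t *ᵥ (H t *ᵥ pe t)) - uhat t)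
    {y : ℝ → Fin m → ℝ} (hy : y = fun t => z t - zhat t) :
    ∫ t, pe t ⬝ᵥ pe t ∂(volume.restrict (Icc a b))
      + (Fplus *ᵥ (F *ᵥ pe b)) ⬝ᵥ (Fplus *ᵥ (F *ᵥ pe b))
      + ε * (∫ t, ((R t)⁻¹ *ᵥ v t) ⬝ᵥ v t ∂(volume.restrict (Icc a b))
        + ∫ t, ((Q t)⁻¹ *ᵥ y t) ⬝ᵥ y t ∂(volume.restrict (Icc a b))
        + ∫ t, (((R t)⁻¹ *ᵥ uhat t) ⬝ᵥ v t + ((Q t)⁻¹ *ᵥ zhat t) ⬝ᵥ y t)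
          ∂(volume.restrict (Icc a b))) = 0 := by
  have hdiff := fun t ht => hEL.sub_adjoint hab hC hH hR huhat hzhat (t := t) ht
  have hQi := continuousOn_matrix_inv hQ hQpd
  have hRi := continuousOn_matrix_inv hR hRpd
  obtain ⟨hp, hz, hFp, -⟩ := hEL
  rw [l2On_iff_memLp] at hp hz huhat
  have hzh := l2On_iff_memLp.1 hzhat.1
  have hvL : MemLp v 2 (volume.restrict (Icc a b)) := by
    rw [hv]
    exact ((memLp_mulVec hR (memLp_mulVec hH hp)).const_smul (1 / ε)).sub huhat
  have hyL : MemLp y 2 (volume.restrict (Icc a b)) := by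
    rw [hy]
    exact hz.sub hzh
  have hα : MemLp (fun s => C s *ᵥ pe s + ε • ((Q s)⁻¹ *ᵥ z s)) 2 (volume.restrict (Icc a b)) :=
    (memLp_mulVec hC hp).add ((memLp_mulVec hQi hz).const_smul ε)
  have hβ : MemLp (fun s => -((C s)ᵀ *ᵥ y s) + (H s)ᵀ *ᵥ v s + pe s) 2
      (volume.restrict (Icc a b)) := (memLp_adjoint_integrand hC hH hvL hyL).add hp
  have hgreen := green_formula hab hF (x := pe) (y := y) hα hβ hFp
    (b0 := -(Fplus *ᵥ (F *ᵥ pe b))) (fun t ht => by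
      have h := hdiff t ht
      simpa only [hy, hv] using h)
  have i1 := integrable_dotProduct hp hp
  have i2 := integrable_dotProduct (memLp_mulVec hRi hvL) hvL
  have i3 := integrable_dotProduct (memLp_mulVec hQi hyL) hyL
  have i4 := (integrable_dotProduct (memLp_mulVec hRi huhat) hvL).fun_add
    (integrable_dotProduct (memLp_mulVec hQi hzh) hyL)
  rw [← integral_add (integrable_dotProduct hα hyL) (integrable_dotProduct hp hβ),
    dotProduct_neg] at hgreen
  have hexp : ∫ t, ((C t *ᵥ pe t + ε • ((Q t)⁻¹ *ᵥ z t)) ⬝ᵥ y t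
        + pe t ⬝ᵥ (-((C t)ᵀ *ᵥ y t) + (H t)ᵀ *ᵥ v t + pe t)) ∂(volume.restrict (Icc a b))
      = ∫ t, (pe t ⬝ᵥ pe t + ε * (((R t)⁻¹ *ᵥ v t) ⬝ᵥ v t + ((Q t)⁻¹ *ᵥ y t) ⬝ᵥ y t
        + (((R t)⁻¹ *ᵥ uhat t) ⬝ᵥ v t + ((Q t)⁻¹ *ᵥ zhat t) ⬝ᵥ y t)))
        ∂(volume.restrict (Icc a b)) := by
    refine integral_congr_ae ?_
    filter_upwards [ae_restrict_mem measurableSet_Icc] with t ht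
    have hzt : z t = y t + zhat t := by rw [hy]; simp
    have hHp : H t *ᵥ pe t = ε • ((R t)⁻¹ *ᵥ (v t + uhat t)) := by
      have hunit : IsUnit (R t).det := (hRpd t ht).det_pos.ne'.isUnit
      simp only [hv, sub_add_cancel]
      rw [mulVec_smul, mulVec_mulVec, nonsing_inv_mul _ hunit, one_mulVec, smul_smul,
        mul_one_div_cancel hε.ne', one_smul]
    have hHv : pe t ⬝ᵥ ((H t)ᵀ *ᵥ v t)
        = ε * (((R t)⁻¹ *ᵥ v t) ⬝ᵥ v t + ((R t)⁻¹ *ᵥ uhat t) ⬝ᵥ v t) := by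
      rw [dotProduct_mulVec, vecMul_transpose, hHp, smul_dotProduct, mulVec_add, add_dotProduct,
        smul_eq_mul]
    have hCy : pe t ⬝ᵥ ((C t)ᵀ *ᵥ y t) = (C t *ᵥ pe t) ⬝ᵥ y t := by
      rw [dotProduct_mulVec, vecMul_transpose]
    rw [dotProduct_add, dotProduct_add, dotProduct_neg, hHv, hCy, hzt, mulVec_add, add_dotProduct,
      smul_dotProduct, add_dotProduct, smul_eq_mul]
    ring
  rw [hexp, integral_add i1 (((i2.fun_add i3).fun_add i4).const_mul ε), integral_const_mul,
    integral_add (i2.fun_add i3) i4, integral_add i2 i3] at hgreen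
  linarith

lemma memLp_sumElim {k l : ℕ} {μ : Measure ℝ} {f : ℝ → Fin k → ℝ} {g : ℝ → Fin l → ℝ}
    (hf : MemLp f 2 μ) (hg : MemLp g 2 μ) : MemLp (fun t => Sum.elim (f t) (g t)) 2 μ := by
  refine MemLp.of_eval ?_
  rintro (i | i)
  · exact hf.eval i
  · exact hg.eval i

lemma dotProduct_self_nonneg' {ι : Type*} [Fintype ι] (v : ι → ℝ) : 0 ≤ v ⬝ᵥ v :=
  Finset.sum_nonneg fun i _ => mul_self_nonneg (v i)

lemma integral_sq_norm_le {k : ℕ} {a b : ℝ} {x : ℝ → Fin k → ℝ}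
    (hx : MemLp x 2 (volume.restrict (Icc a b))) :
    ∫ t, ‖x t‖ ^ 2 ∂(volume.restrict (Icc a b)) ≤
      ∫ t, x t ⬝ᵥ x t ∂(volume.restrict (Icc a b)) :=
  integral_mono ((memLp_two_iff_integrable_sq_norm hx.1).1 hx) (integrable_dotProduct hx hx)
    fun t => sq_norm_le_dotProduct (x t)

lemma integral_coercive {k : ℕ} {a b c : ℝ} {A : ℝ → Matrix (Fin k) (Fin k) ℝ}
    (hA : ContinuousOn A (Icc a b))
    (hc : ∀ t ∈ Icc a b, ∀ v : Fin k → ℝ, c * (v ⬝ᵥ v) ≤ (A t *ᵥ v) ⬝ᵥ v) {x : ℝ → Fin k → ℝ}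
    (hx : MemLp x 2 (volume.restrict (Icc a b))) :
    c * ∫ t, x t ⬝ᵥ x t ∂(volume.restrict (Icc a b)) ≤
      ∫ t, (A t *ᵥ x t) ⬝ᵥ x t ∂(volume.restrict (Icc a b)) := by
  rw [← integral_const_mul]
  refine integral_mono_ae ((integrable_dotProduct hx hx).const_mul c)
    (integrable_dotProduct (memLp_mulVec hA hx) hx) ?_
  filter_upwards [ae_restrict_mem measurableSet_Icc] with t ht using hc t ht (x t)

/-- Proposition 1, Tikhonov regularization: convergence.
If for every `ε > 0` the pair `(p̂(ε), ẑ(ε))` solves the Euler–Lagrange system, and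
`(û, ẑ)` minimizes `∫⟨Q⁻¹z,z⟩ + ∫⟨R⁻¹u,u⟩` over all pairs `(u,z)` with `u ∈ L²` and
`z` solving the adjoint DAE with data `(u,ℓ)`, then `û(ε) := (1/ε)RHp̂(ε) → û` in
`L²(t0,T;ℝᵖ)` and `ẑ(ε) → ẑ` in `L²(t0,T;ℝᵐ)` as `ε → 0`. -/
theorem tikhonov_convergence
    {m n p : ℕ} (t0 T : ℝ) (hT : t0 < T)
    (F : Matrix (Fin m) (Fin n) ℝ)
    (C : ℝ → Matrix (Fin m) (Fin n) ℝ) (hC : ContinuousOn C (Icc t0 T))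
    (H : ℝ → Matrix (Fin p) (Fin n) ℝ) (hH : ContinuousOn H (Icc t0 T))
    (Q : ℝ → Matrix (Fin m) (Fin m) ℝ) (hQ : ContinuousOn Q (Icc t0 T))
    (hQpd : ∀ t ∈ Icc t0 T, (Q t).PosDef)
    (R : ℝ → Matrix (Fin p) (Fin p) ℝ) (hR : ContinuousOn R (Icc t0 T))
    (hRpd : ∀ t ∈ Icc t0 T, (R t).PosDef)
    (Fplus : Matrix (Fin n) (Fin m) ℝ) (hFplus : IsMoorePenrose F Fplus)
    (ℓ : Fin m → ℝ) (hℓ : sigmaHat t0 T F C H Q R ℓ < ⊤)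
    (pfam : ℝ → ℝ → (Fin n → ℝ)) (zfam : ℝ → ℝ → (Fin m → ℝ))
    (hfam : ∀ ε : ℝ, 0 < ε → SolvesEL t0 T F Fplus C H Q R ε ℓ (pfam ε) (zfam ε))
    (uhat : ℝ → (Fin p → ℝ)) (zhat : ℝ → (Fin m → ℝ))
    (huhat : L2On t0 T uhat) (hzhat : SolvesAdjoint t0 T F C H uhat ℓ zhat)
    (hmin : ∀ (u : ℝ → (Fin p → ℝ)) (z : ℝ → (Fin m → ℝ)),
      L2On t0 T u → SolvesAdjoint t0 T F C H u ℓ z →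
        (∫ t in t0..T, ((Q t)⁻¹ *ᵥ zhat t) ⬝ᵥ zhat t) +
            (∫ t in t0..T, ((R t)⁻¹ *ᵥ uhat t) ⬝ᵥ uhat t) ≤
          (∫ t in t0..T, ((Q t)⁻¹ *ᵥ z t) ⬝ᵥ z t) +
            (∫ t in t0..T, ((R t)⁻¹ *ᵥ u t) ⬝ᵥ u t)) :
    Tendsto (fun ε : ℝ =>
        ∫ t in t0..T, ‖(1 / ε) • ((R t) *ᵥ ((H t) *ᵥ pfam ε t)) - uhat t‖ ^ 2)
      (𝓝[>] (0 : ℝ)) (𝓝 0) ∧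
    Tendsto (fun ε : ℝ => ∫ t in t0..T, ‖zfam ε t - zhat t‖ ^ 2)
      (𝓝[>] (0 : ℝ)) (𝓝 0) := by
  have hab := hT.le
  set μ : Measure ℝ := volume.restrict (Icc t0 T) with hμ
  have hQi := continuousOn_matrix_inv hQ hQpd
  have hRi := continuousOn_matrix_inv hR hRpd
  have huL : MemLp uhat 2 μ := l2On_iff_memLp.1 huhat
  have hzL : MemLp zhat 2 μ := l2On_iff_memLp.1 hzhat.1
  obtain ⟨c₁, hc₁, hcR⟩ := exists_coercive hRi fun t ht => (hRpd t ht).inv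
  obtain ⟨c₂, hc₂, hcQ⟩ := exists_coercive hQi fun t ht => (hQpd t ht).inv
  set c := min c₁ c₂ with hc_def
  have hc : 0 < c := lt_min hc₁ hc₂
  set v : ℝ → ℝ → Fin p → ℝ := fun ε t =>
    (1 / ε) • (R t *ᵥ (H t *ᵥ pfam ε t)) - uhat t with hv
  set y : ℝ → ℝ → Fin m → ℝ := fun ε t => zfam ε t - zhat t with hy
  have hpL : ∀ ε, 0 < ε → MemLp (pfam ε) 2 μ := fun ε hε => l2On_iff_memLp.1 (hfam ε hε).1
  have hvL : ∀ ε, 0 < ε → MemLp (v ε) 2 μ := fun ε hε =>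
    ((memLp_mulVec hR (memLp_mulVec hH (hpL ε hε))).const_smul (1 / ε)).sub huL
  have hyL : ∀ ε, 0 < ε → MemLp (y ε) 2 μ := fun ε hε =>
    (l2On_iff_memLp.1 (hfam ε hε).2.1).sub hzL
  let w : ℝ → ℝ → Fin p ⊕ Fin m → ℝ := fun ε t => Sum.elim (v ε t) (y ε t)
  let g : ℝ → Fin p ⊕ Fin m → ℝ := fun t =>
    Sum.elim ((R t)⁻¹ *ᵥ uhat t) ((Q t)⁻¹ *ᵥ zhat t)
  have hgL : MemLp g 2 μ := memLp_sumElim (memLp_mulVec hRi huL) (memLp_mulVec hQi hzL)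
  have hwL : ∀ ε, 0 < ε → MemLp (w ε) 2 μ := fun ε hε => memLp_sumElim (hvL ε hε) (hyL ε hε)
  let q : ℝ → Fin n → ℝ := fun ε => Fplus *ᵥ (F *ᵥ pfam ε T)
  set Γ : ℝ := ∫ t, g t ⬝ᵥ g t ∂μ with hΓ
  have hΓ0 : 0 ≤ Γ := integral_nonneg fun t => dotProduct_self_nonneg' _
  have hww : ∀ ε, 0 < ε → ∫ t, w ε t ⬝ᵥ w ε t ∂μ
      = ∫ t, v ε t ⬝ᵥ v ε t ∂μ + ∫ t, y ε t ⬝ᵥ y ε t ∂μ := by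
    intro ε hε
    rw [← integral_add (integrable_dotProduct (hvL ε hε) (hvL ε hε))
      (integrable_dotProduct (hyL ε hε) (hyL ε hε))]
    simp only [w, sumElim_dotProduct_sumElim]
  have hestimate : ∀ ε, 0 < ε →
      c * ∫ t, w ε t ⬝ᵥ w ε t ∂μ ≤ -∫ t, g t ⬝ᵥ w ε t ∂μ ∧
      ∫ t, w ε t ⬝ᵥ w ε t ∂μ ≤ Γ / c ^ 2 ∧
      ∫ t, pfam ε t ⬝ᵥ pfam ε t ∂μ + q ε ⬝ᵥ q ε ≤ ε * (Γ / c) := by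
    intro ε hε
    have henergy := (hfam ε hε).energy_identity hab hFplus hC hH hQ hQpd hR hRpd hε huhat hzhat
      (v := v ε) (y := y ε) rfl rfl
    simp only [← sumElim_dotProduct_sumElim] at henergy
    change ∫ t, pfam ε t ⬝ᵥ pfam ε t ∂μ + q ε ⬝ᵥ q ε + ε * (_ + _ + ∫ t, g t ⬝ᵥ w ε t ∂μ) = 0
      at henergy
    have hcv := integral_coercive hRi hcR (hvL ε hε)
    have hcy := integral_coercive hQi hcQ (hyL ε hε)
    have hvv : 0 ≤ ∫ t, v ε t ⬝ᵥ v ε t ∂μ := integral_nonneg fun t => dotProduct_self_nonneg' _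
    have hyy : 0 ≤ ∫ t, y ε t ⬝ᵥ y ε t ∂μ := integral_nonneg fun t => dotProduct_self_nonneg' _
    have hpp : 0 ≤ ∫ t, pfam ε t ⬝ᵥ pfam ε t ∂μ :=
      integral_nonneg fun t => dotProduct_self_nonneg' _
    have hqq : 0 ≤ q ε ⬝ᵥ q ε := dotProduct_self_nonneg' _
    have hcv' := (mul_le_mul_of_nonneg_right (min_le_left c₁ c₂) hvv).trans hcv
    have hcy' := (mul_le_mul_of_nonneg_right (min_le_right c₁ c₂) hyy).trans hcy
    have hyoung := abs_integral_dotProduct_le hgL (hwL ε hε) (inv_pos.2 hc)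
    have hyoung' := (neg_le_abs _).trans hyoung
    rw [← hΓ, show 1 / (2 * c⁻¹) = c / 2 by field_simp] at hyoung'
    rw [← hc_def] at hcv' hcy'
    have hN := hww ε hε
    set N := ∫ t, w ε t ⬝ᵥ w ε t ∂μ
    set G := ∫ t, g t ⬝ᵥ w ε t ∂μ
    set W := ∫ t, ((R t)⁻¹ *ᵥ v ε t) ⬝ᵥ v ε t ∂volume.restrict (Icc t0 T)
      + ∫ t, ((Q t)⁻¹ *ᵥ y ε t) ⬝ᵥ y ε t ∂volume.restrict (Icc t0 T) with hW
    have hWN : c * N ≤ W := by rw [hN, mul_add]; exact add_le_add hcv' hcy'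
    have hN0 : 0 ≤ N := by rw [hN]; exact add_nonneg hvv hyy
    have hWG : W + G ≤ 0 := by
      by_contra! h
      linarith [mul_pos hε h]
    have h1 : c * N ≤ -G := by linarith
    have h2 : N ≤ Γ / c ^ 2 := by
      have h3 : c * N ≤ c⁻¹ * Γ := by linarith
      rw [le_div_iff₀ (by positivity)]
      calc N * c ^ 2 = c * (c * N) := by ring
        _ ≤ c * (c⁻¹ * Γ) := by gcongr
        _ = Γ := by field_simp
    have h4 : -G ≤ Γ / c := by
      calc -G ≤ c⁻¹ / 2 * Γ + c / 2 * N := hyoung'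
        _ ≤ c⁻¹ / 2 * Γ + c / 2 * (Γ / c ^ 2) := by gcongr
        _ = Γ / c := by field_simp; ring
    refine ⟨h1, h2, ?_⟩
    have h5 : -(W + G) ≤ Γ / c := by linarith [mul_nonneg hc.le hN0]
    linarith [mul_le_mul_of_nonneg_left h5 hε.le]
  have hev : ∀ᶠ ε : ℝ in 𝓝[>] (0 : ℝ), 0 < ε := self_mem_nhdsWithin
  let test : (ℝ → Fin n → ℝ) → ℝ → Fin p ⊕ Fin m → ℝ := fun ρ t =>
    Sum.elim (H t *ᵥ ∫ s in t0..t, ρ s) (F *ᵥ ρ t - C t *ᵥ ∫ s in t0..t, ρ s)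
  have hG : Tendsto (fun ε => ∫ t, g t ⬝ᵥ w ε t ∂μ) (𝓝[>] (0 : ℝ)) (𝓝 0) := by
    refine tendsto_integral_dotProduct_zero {h | ∃ ρ, MemLp ρ 2 μ ∧ h = test ρ} ?_ g hgL ?_ _ w
      (hev.mono hwL) (Γ / c ^ 2) (hev.mono fun ε hε => (hestimate ε hε).2.1) ?_
    · rintro _ ⟨ρ, hρ, rfl⟩
      have hr := memLp_of_continuousOn_Icc (continuousOn_primitive_left hab hρ) 2
      exact memLp_sumElim (memLp_mulVec hH hr)
        ((memLp_const_mulVec F hρ).sub (memLp_mulVec hC hr))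
    · intro ω hω htest
      have h1 : MemLp (fun t i => ω t (Sum.inl i)) 2 μ := MemLp.of_eval fun i => hω.eval _
      have h2 : MemLp (fun t i => ω t (Sum.inr i)) 2 μ := MemLp.of_eval fun i => hω.eval _
      have hω' : ∀ t, ω t = Sum.elim (fun i => ω t (Sum.inl i)) (fun i => ω t (Sum.inr i)) :=
        fun t => (Sum.elim_comp_inl_inr (ω t)).symm
      have hρ := (memLp_const_mulVec Fᵀ h2).add (memLp_of_continuousOn_Icc
        (continuousOn_primitive_right hab (memLp_adjoint_integrand hC hH h1 h2)) 2)
      have hzero := htest _ ⟨_, hρ, rfl⟩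
      have hdot : ∀ ρ t, test ρ t ⬝ᵥ ω t =
          (H t *ᵥ ∫ s in t0..t, ρ s) ⬝ᵥ (fun i => ω t (Sum.inl i))
            + (F *ᵥ ρ t - C t *ᵥ ∫ s in t0..t, ρ s) ⬝ᵥ (fun i => ω t (Sum.inr i)) := by
        intro ρ t
        conv_lhs => rw [hω' t]
        exact sumElim_dotProduct_sumElim ..
      simp only [hdot] at hzero
      rw [integral_test_eq hab hC hH hρ h1 h2] at hzero
      have hres := (integral_eq_zero_iff_of_nonneg (fun t => dotProduct_self_nonneg' _)
        (integrable_dotProduct hρ hρ)).1 hzero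
      have hopt := integral_eq_zero_of_homogeneous_adjoint hT hFplus hC hH hQi
        (fun t ht => (hQpd t ht).inv) hRi (fun t ht => (hRpd t ht).inv) huhat hzhat hmin h1 h2 (by
          filter_upwards [hres] with t ht using dotProduct_self_eq_zero.1 ht)
      rw [← hopt]
      refine integral_congr_ae (Eventually.of_forall fun t => ?_)
      simp only [g]
      rw [← sumElim_dotProduct_sumElim, ← hω' t]
    · rintro _ ⟨ρ, hρ, rfl⟩
      have hr := memLp_of_continuousOn_Icc (continuousOn_primitive_left hab hρ) 2
      set I := ∫ t in t0..T, ρ t with hI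
      have hpair : ∀ ε, 0 < ε → ∫ t, test ρ t ⬝ᵥ w ε t ∂μ
          = -(I ⬝ᵥ q ε) - ∫ t, (∫ s in t0..t, ρ s) ⬝ᵥ pfam ε t ∂μ := by
        intro ε hε
        have hqL : MemLp (fun _ : ℝ => q ε) 2 μ := memLp_of_continuousOn_Icc continuousOn_const 2
        have hPL := memLp_of_continuousOn_Icc (continuousOn_primitive_right hab (hpL ε hε)) 2
        simp only [test, w, sumElim_dotProduct_sumElim]
        rw [integral_test_eq hab hC hH hρ (hvL ε hε) (hyL ε hε), hI,
          intervalIntegral_eq_integral_restrict_Icc hab,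
          ← integral_dotProduct_const (hρ.integrable one_le_two),
          ← intervalIntegral_eq_integral_restrict_Icc hab
            (fun t => (∫ s in t0..t, ρ s) ⬝ᵥ pfam ε t),
          integral_primitive_dotProduct_eq hab hρ (hpL ε hε),
          intervalIntegral_eq_integral_restrict_Icc hab, ← integral_neg,
          ← integral_sub (integrable_dotProduct hρ hqL).fun_neg (integrable_dotProduct hρ hPL)]
        refine integral_congr_ae ?_
        filter_upwards [ae_restrict_mem measurableSet_Icc] with t ht
        have hres := (hfam ε hε).sub_adjoint hab hC hH hR huhat hzhat ht
        rw [intervalIntegral.integral_add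
          (intervalIntegrable_of_mem_Icc (memLp_adjoint_integrand hC hH (hvL ε hε) (hyL ε hε)) ht
            (right_mem_Icc.2 hab))
          (intervalIntegrable_of_mem_Icc (hpL ε hε) ht (right_mem_Icc.2 hab))] at hres
        have hsum : Fᵀ *ᵥ y ε t + ∫ s in t..T, (-((C s)ᵀ *ᵥ y ε s) + (H s)ᵀ *ᵥ v ε s)
            = -q ε - ∫ s in t..T, pfam ε s := by
          simp only [hy, hv, q, hres]
          abel
        rw [hsum, dotProduct_sub, dotProduct_neg]
      set K : ℝ := I ⬝ᵥ I + ∫ t, (∫ s in t0..t, ρ s) ⬝ᵥ (∫ s in t0..t, ρ s) ∂μ with hK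
      have hlim0 : Tendsto (fun ε : ℝ => √ε / 2 * (K + Γ / c)) (𝓝[>] (0 : ℝ)) (𝓝 0) := by
        have hcont : Continuous fun ε : ℝ => √ε / 2 * (K + Γ / c) := by fun_prop
        simpa using (hcont.tendsto 0).mono_left nhdsWithin_le_nhds
      refine squeeze_zero_norm' ?_ hlim0
      filter_upwards [hev] with ε hε
      have hδ : 0 < √ε := Real.sqrt_pos.2 hε
      have hIq := abs_dotProduct_le I (q ε) hδ
      have hrp := abs_integral_dotProduct_le hr (hpL ε hε) hδ
      have hsmall := mul_le_mul_of_nonneg_left (hestimate ε hε).2.2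
        (show 0 ≤ 1 / (2 * √ε) by positivity)
      have hscale : 1 / (2 * √ε) * (ε * (Γ / c)) = √ε / 2 * (Γ / c) := by
        nth_rewrite 2 [← Real.mul_self_sqrt hε.le]
        field_simp
      rw [hpair ε hε, Real.norm_eq_abs]
      refine (abs_sub _ _).trans ?_
      rw [abs_neg]
      rw [hscale, mul_add] at hsmall
      rw [mul_add, hK, mul_add]
      linarith
  have hlim : Tendsto (fun ε => c⁻¹ * -∫ t, g t ⬝ᵥ w ε t ∂μ) (𝓝[>] (0 : ℝ)) (𝓝 0) := by
    simpa using hG.neg.const_mul c⁻¹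
  have hbound : ∀ ε, 0 < ε →
      ∫ t, v ε t ⬝ᵥ v ε t ∂μ + ∫ t, y ε t ⬝ᵥ y ε t ∂μ ≤ c⁻¹ * -∫ t, g t ⬝ᵥ w ε t ∂μ := by
    intro ε hε
    rw [← hww ε hε, ← div_eq_inv_mul, le_div_iff₀ hc, mul_comm]
    exact (hestimate ε hε).1
  simp only [intervalIntegral_eq_integral_restrict_Icc hab]
  refine ⟨tendsto_of_tendsto_of_tendsto_of_le_of_le' tendsto_const_nhds hlim ?_ ?_,
    tendsto_of_tendsto_of_tendsto_of_le_of_le' tendsto_const_nhds hlim ?_ ?_⟩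
  · exact Eventually.of_forall fun ε => integral_nonneg fun t => by positivity
  · filter_upwards [hev] with ε hε
    have hyy : 0 ≤ ∫ t, y ε t ⬝ᵥ y ε t ∂μ := integral_nonneg fun t => dotProduct_self_nonneg' _
    exact (integral_sq_norm_le (hvL ε hε)).trans (by linarith [hbound ε hε])
  · exact Eventually.of_forall fun ε => integral_nonneg fun t => by positivity
  · filter_upwards [hev] with ε hε
    have hvv : 0 ≤ ∫ t, v ε t ⬝ᵥ v ε t ∂μ := integral_nonneg fun t => dotProduct_self_nonneg' _
    exact (integral_sq_norm_le (hyL ε hε)).trans (by linarith [hbound ε hε])
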